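/- arXiv:1610.00935 — 2 statements merged into one kernel-verified Lean document; each statement's English description precedes it below -/
import Mathlib

section
/- Let k ≥ 4 and let C* ∈ F*(K_3^{+k}, C_{t_k}) with underlying tight cycle C*_{t_k} whose vertices are labelled 0, …, t_k-1 so that e_i = {i, i+1, …, i+k-1} (indices modulo t_k) for 0 ≤ i ≤ t_k-1, with attachment edge e_0, and for 1 ≤ i ≤ t_k-1 let F^i ⊆ C* be the copy of K_3^{+k} containing e_i and let v_i be the vertex with V(F^i) = e_i ∪ {v_i}. Let I ⊆ {i : v_i ∉ V(C*_{t_k})} and S = {v_i : i ∈ I}. Then the number of edges of C* incident to S is at least |I| + |S|. -/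
open scoped Classical

namespace ARR

/-- The vertex support of a hypergraph given by its edge set. -/
def vset (G : Finset (Finset ℕ)) : Finset ℕ := G.sup id

/-- Number of vertices of a hypergraph. -/
def vcount (G : Finset (Finset ℕ)) : ℕ := (vset G).card

/-- `G` is a `k`-uniform hypergraph. -/
def IsUniform (k : ℕ) (G : Finset (Finset ℕ)) : Prop := ∀ e ∈ G, e.card = k

/-- The `k`-density `d_k`. -/
noncomputable def dk (k : ℕ) (G : Finset (Finset ℕ)) : ℝ :=
  if G.card = 0 then 0
  else if G.card = 1 ∧ vcount G = k then 1 / (k : ℝ)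
  else ((G.card : ℝ) - 1) / ((vcount G : ℝ) - (k : ℝ))

/-- The `k`-density `m_k`: the maximum of `d_k` over subgraphs. -/
noncomputable def mk (k : ℕ) (G : Finset (Finset ℕ)) : ℝ :=
  sSup {x : ℝ | ∃ H ⊆ G, x = dk k H}

/-- The usual density `m(G)`. -/
noncomputable def mDens (G : Finset (Finset ℕ)) : ℝ :=
  sSup {x : ℝ | ∃ H ⊆ G, 1 ≤ vcount H ∧ x = (H.card : ℝ) / (vcount H : ℝ)}

/-- `G` is strictly `k`-balanced: every proper subgraph has strictly smaller `k`-density. -/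
def StrictlyKBalanced (k : ℕ) (G : Finset (Finset ℕ)) : Prop :=
  ∀ H ⊆ G, H ≠ G → dk k H < dk k G

/-- The asymmetric `k`-density `m_k(F₁,F₂)`. -/
noncomputable def mkA (k : ℕ) (F1 F2 : Finset (Finset ℕ)) : ℝ :=
  sSup {x : ℝ | ∃ H ⊆ F1, H.Nonempty ∧
    x = (H.card : ℝ) / ((vcount H : ℝ) - (k : ℝ) + 1 / mk k F2)}

/-- `F₁` is strictly balanced with respect to `m_k(·, F₂)`. -/
def StrictlyBalancedWrt (k : ℕ) (F1 F2 : Finset (Finset ℕ)) : Prop :=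
  ∀ H ⊆ F1, H.Nonempty → H ≠ F1 →
    (H.card : ℝ) / ((vcount H : ℝ) - (k : ℝ) + 1 / mk k F2) < mkA k F1 F2

/-- `F'` is a copy of `F` (an isomorphic image of `F`). -/
def IsCopy (F F' : Finset (Finset ℕ)) : Prop :=
  ∃ f : ℕ → ℕ, Set.InjOn f ↑(vset F) ∧ F' = F.image (Finset.image f)

/-- `G` contains a copy of `F`. -/
def ContainsCopy (G F : Finset (Finset ℕ)) : Prop := ∃ F' ⊆ G, IsCopy F F'

/-- Asymmetric Ramsey arrow `G → (F₁, …, F_r)`. -/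
def Arrow {r : ℕ} (G : Finset (Finset ℕ)) (F : Fin r → Finset (Finset ℕ)) : Prop :=
  ∀ χ : Finset ℕ → Fin r, ∃ i : Fin r, ∃ F' ⊆ G, IsCopy (F i) F' ∧ ∀ e ∈ F', χ e = i

/-- Symmetric Ramsey arrow `G → (F)_r`. -/
def ArrowSym (G F : Finset (Finset ℕ)) (r : ℕ) : Prop :=
  ∀ χ : Finset ℕ → Fin r, ∃ i : Fin r, ∃ F' ⊆ G, IsCopy F F' ∧ ∀ e ∈ F', χ e = i

/-- Two-colour asymmetric arrow `G → (F₁, F₂)`. -/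
def Arrow2 (G F1 F2 : Finset (Finset ℕ)) : Prop :=
  ∀ χ : Finset ℕ → Fin 2,
    (∃ F' ⊆ G, IsCopy F1 F' ∧ ∀ e ∈ F', χ e = 0) ∨
    (∃ F' ⊆ G, IsCopy F2 F' ∧ ∀ e ∈ F', χ e = 1)

/-- The edge set of the complete `k`-uniform hypergraph on `{0, …, n-1}`. -/
def allEdges (k n : ℕ) : Finset (Finset ℕ) := (Finset.range n).powersetCard k

/-- Probability that the binomial random hypergraph `H^k(n,p)` satisfies property `P`. -/
noncomputable def prob (k n : ℕ) (p : ℝ) (P : Finset (Finset ℕ) → Prop) : ℝ :=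
  ∑ G ∈ (allEdges k n).powerset,
    if P G then p ^ G.card * (1 - p) ^ ((allEdges k n).card - G.card) else 0

/-- Expected number of members of a family `𝓕` which appear as subgraphs of `H^k(n,p)`. -/
noncomputable def expectCount (k n : ℕ) (p : ℝ) (𝓕 : Finset (Finset (Finset ℕ))) : ℝ :=
  ∑ G ∈ (allEdges k n).powerset,
    (p ^ G.card * (1 - p) ^ ((allEdges k n).card - G.card)) *
      ((𝓕.filter (fun F => F ⊆ G)).card : ℝ)

/-- `K₃^{+k}`: the triangle on `{0,1,2}` with the `k-2` vertices `{3,…,k}` added to each edge. -/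
def K3plus (k : ℕ) : Finset (Finset ℕ) :=
  {({0, 1} : Finset ℕ) ∪ (Finset.range (k + 1)).filter (fun x => 3 ≤ x),
   ({0, 2} : Finset ℕ) ∪ (Finset.range (k + 1)).filter (fun x => 3 ≤ x),
   ({1, 2} : Finset ℕ) ∪ (Finset.range (k + 1)).filter (fun x => 3 ≤ x)}

/-- The `i`-th edge `{i, i+1, …, i+k-1}` (mod `t`) of the tight cycle on `t` vertices. -/
def cycEdge (k t i : ℕ) : Finset ℕ := (Finset.range k).image (fun j => (i + j) % t)

/-- The tight cycle `C_t` (k-uniform) on vertex set `{0, …, t-1}`. -/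
def tightCycle (k t : ℕ) : Finset (Finset ℕ) := (Finset.range t).image (cycEdge k t)

/-- The tight path `T^k_ℓ` on vertex set `{0, …, ℓ-1}`. -/
def tightPath (k l : ℕ) : Finset (Finset ℕ) :=
  (Finset.range (l - k + 1)).image (fun i => (Finset.range k).image (fun j => i + j))

/-- The cycle length `t_k`: `t₄ = 8`, `t₅ = 14`, and `t_k = k²` for `k ≥ 6`. -/
def tk (k : ℕ) : ℕ := if k = 4 then 8 else if k = 5 then 14 else k ^ 2

/-- Shift all vertices of a hypergraph by `a` (used to form vertex-disjoint unions). -/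
def shiftHG (a : ℕ) (G : Finset (Finset ℕ)) : Finset (Finset ℕ) :=
  G.image (Finset.image (· + a))

/-- A set of edges is `m`-intersecting if any two distinct edges meet in at most `m` vertices. -/
def IntersectingLE (m : ℕ) (S : Finset (Finset ℕ)) : Prop :=
  ∀ e ∈ S, ∀ f ∈ S, e ≠ f → (e ∩ f).card ≤ m

/-- `e₀` is an attachment edge of `Fst` as a member of the family `F*(F₁,F₂)`. -/
def IsAttachment (F1 F2 Fst : Finset (Finset ℕ)) (e0 : Finset ℕ) : Prop :=
  ∃ F2' : Finset (Finset ℕ), e0 ∈ F2' ∧ IsCopy F2 F2' ∧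
    ∃ g : Finset ℕ → Finset (Finset ℕ),
      (∀ e ∈ F2'.erase e0, IsCopy F1 (g e) ∧ e ∈ g e) ∧
      Fst = F2' ∪ (F2'.erase e0).biUnion g

/-- `Fst` is a member of the family `F*(F₁,F₂)`. -/
def IsFStar (F1 F2 Fst : Finset (Finset ℕ)) : Prop := ∃ e0, IsAttachment F1 F2 Fst e0

/-- `Fst` is a generic member of `F*(F₁,F₂)`. -/
def IsGeneric (F1 F2 Fst : Finset (Finset ℕ)) : Prop :=
  ∃ F2' : Finset (Finset ℕ), ∃ e0 ∈ F2', IsCopy F2 F2' ∧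
    ∃ g : Finset ℕ → Finset (Finset ℕ),
      (∀ e ∈ F2'.erase e0, IsCopy F1 (g e) ∧ e ∈ g e) ∧
      Fst = F2' ∪ (F2'.erase e0).biUnion g ∧
      (∀ e ∈ F2'.erase e0, vset (g e) ∩ vset F2' = e) ∧
      (∀ e ∈ F2'.erase e0, ∀ e' ∈ F2'.erase e0, e ≠ e' →
        (vset (g e) \ e) ∩ (vset (g e') \ e') = ∅)

/-- The family `F*(F₁,F₂)` is asymmetric-balanced. -/
def AsymBalanced (k : ℕ) (F1 F2 : Finset (Finset ℕ)) : Prop :=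
  ∀ Fst, IsFStar F1 F2 Fst →
    ∀ H ⊆ Fst, vset H ⊂ vset Fst → (∃ e0 ∈ H, IsAttachment F1 F2 Fst e0) →
      mkA k F1 F2 ≤ ((Fst.card : ℝ) - (H.card : ℝ)) / ((vcount Fst : ℝ) - (vcount H : ℝ)) ∧
      (((Fst.card : ℝ) - (H.card : ℝ)) / ((vcount Fst : ℝ) - (vcount H : ℝ)) = mkA k F1 F2 →
        (∃ e0, IsAttachment F1 F2 Fst e0 ∧ H = {e0}) ∧ IsGeneric F1 F2 Fst)

/-- An edge `e` of `G` is closed (w.r.t. `F₁`, `F₂`): it lies in a copy of `F₁` and a copy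
of `F₂` inside `G` whose edge sets intersect exactly in `{e}`. -/
def ClosedEdge (F1 F2 G : Finset (Finset ℕ)) (e : Finset ℕ) : Prop :=
  ∃ A ⊆ G, ∃ B ⊆ G, IsCopy F1 A ∧ IsCopy F2 B ∧ A ∩ B = {e}

/-- Every edge of `G` is closed within `G`. -/
def SelfClosed (F1 F2 G : Finset (Finset ℕ)) : Prop := ∀ e ∈ G, ClosedEdge F1 F2 G e

/-- `Ĥ`: the subgraph of `H` obtained by repeatedly deleting open edges; equivalently the
largest subgraph of `H` all of whose edges are closed within it. -/
noncomputable def hatH (F1 F2 H : Finset (Finset ℕ)) : Finset (Finset ℕ) :=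
  (H.powerset.filter (fun G => SelfClosed F1 F2 G)).sup id

/-- `G'` is an `(F₁,F₂)`-core of `Ĥ`. -/
def IsCore (F1 F2 H G' : Finset (Finset ℕ)) : Prop :=
  G' ⊆ hatH F1 F2 H ∧
    ∀ A ⊆ hatH F1 F2 H, (IsCopy F1 A ∨ IsCopy F2 A) → (A ⊆ G' ∨ A ∩ G' = ∅)

/-- `G'` is a minimal (nonempty) closed `(F₁,F₂)`-core of `Ĥ`. -/
def IsMinimalCore (F1 F2 H G' : Finset (Finset ℕ)) : Prop :=
  G'.Nonempty ∧ IsCore F1 F2 H G' ∧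
    ∀ G'' ⊆ G', G''.Nonempty → G'' ≠ G' → ¬ IsCore F1 F2 H G''


lemma tk_ge (k : ℕ) (hk : 4 ≤ k) : 2 * k ≤ tk k := by
  unfold tk
  split_ifs with h1 h2
  · omega
  · omega
  · nlinarith

lemma vset_K3plus (k : ℕ) (hk : 4 ≤ k) : vset (K3plus k) = Finset.range (k + 1) := by
  ext x
  simp only [vset, K3plus, Finset.sup_insert, Finset.sup_singleton, id, Finset.sup_eq_union,
    Finset.mem_union, Finset.mem_insert, Finset.mem_singleton, Finset.mem_filter,
    Finset.mem_range]
  omega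

lemma K3plus_eq (k : ℕ) (hk : 4 ≤ k) : K3plus k =
    {(Finset.range (k + 1)).erase 2, (Finset.range (k + 1)).erase 1,
      (Finset.range (k + 1)).erase 0} := by
  unfold K3plus
  congr 1
  · ext x
    simp only [Finset.mem_union, Finset.mem_insert, Finset.mem_singleton, Finset.mem_filter,
      Finset.mem_range, Finset.mem_erase]
    omega
  congr 1
  · ext x
    simp only [Finset.mem_union, Finset.mem_insert, Finset.mem_singleton, Finset.mem_filter,
      Finset.mem_range, Finset.mem_erase]
    omega
  congr 1
  · ext x
    simp only [Finset.mem_union, Finset.mem_insert, Finset.mem_singleton, Finset.mem_filter,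
      Finset.mem_range, Finset.mem_erase]
    omega

lemma image_erase_aux (f : ℕ → ℕ) (R : Finset ℕ) (hf : Set.InjOn f ↑R) (c : ℕ) (hc : c ∈ R) :
    (R.erase c).image f = (R.image f).erase (f c) := by
  ext x
  simp only [Finset.mem_image, Finset.mem_erase]
  constructor
  · rintro ⟨y, ⟨hy, hyR⟩, rfl⟩
    exact ⟨fun h => hy (hf (by simpa using hyR) (by simpa using hc) h), y, hyR, rfl⟩
  · rintro ⟨hx, y, hy, rfl⟩
    exact ⟨y, ⟨fun h => hx (by rw [h]), hy⟩, rfl⟩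

lemma two_edges (k : ℕ) (hk : 4 ≤ k) (G : Finset (Finset ℕ)) (hG : IsCopy (K3plus k) G)
    (e : Finset ℕ) (x : ℕ) (he : e ∈ G) (hx : x ∉ e) (hV : vset G = e ∪ {x}) :
    ∃ a b, a ∈ e ∧ b ∈ e ∧ a ≠ b ∧ insert x (e.erase a) ∈ G ∧ insert x (e.erase b) ∈ G := by
  obtain ⟨f, hf, hGf⟩ := hG
  rw [vset_K3plus k hk] at hf
  have h0 : 0 ∈ Finset.range (k + 1) := by simp
  have h1 : 1 ∈ Finset.range (k + 1) := by simp; omega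
  have h2 : 2 ∈ Finset.range (k + 1) := by simp; omega
  have n01 : f 0 ≠ f 1 := fun h => by have := hf (by simpa using h0) (by simpa using h1) h; omega
  have n02 : f 0 ≠ f 2 := fun h => by have := hf (by simpa using h0) (by simpa using h2) h; omega
  have n12 : f 1 ≠ f 2 := fun h => by have := hf (by simpa using h1) (by simpa using h2) h; omega
  rw [K3plus_eq k hk] at hGf
  simp only [Finset.image_insert, Finset.image_singleton] at hGf
  rw [image_erase_aux f _ hf 0 h0, image_erase_aux f _ hf 1 h1, image_erase_aux f _ hf 2 h2] at hGf
  have m0 : f 0 ∈ (Finset.range (k + 1)).image f := Finset.mem_image_of_mem f h0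
  have m1 : f 1 ∈ (Finset.range (k + 1)).image f := Finset.mem_image_of_mem f h1
  have m2 : f 2 ∈ (Finset.range (k + 1)).image f := Finset.mem_image_of_mem f h2
  generalize (Finset.range (k + 1)).image f = V at hGf m0 m1 m2
  have hVV : V = e ∪ {x} := by
    rw [← hV, hGf]
    ext y
    simp only [vset, Finset.sup_insert, Finset.sup_singleton, id, Finset.sup_eq_union,
      Finset.mem_union, Finset.mem_erase]
    by_cases hy : y = f 0
    · subst hy; tauto
    · tauto
  have key : ∀ c d d', c ∈ V → d ∈ V → d' ∈ V → c ≠ d → c ≠ d' → d ≠ d' → e = V.erase c →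
      V.erase d ∈ G → V.erase d' ∈ G →
      ∃ a b, a ∈ e ∧ b ∈ e ∧ a ≠ b ∧ insert x (e.erase a) ∈ G ∧ insert x (e.erase b) ∈ G := by
    intro c d d' hc hd hd' hcd hcd' hdd hec hdG hdG'
    have hcx : c = x := by
      rw [hVV] at hc
      simp only [Finset.mem_union, Finset.mem_singleton] at hc
      rcases hc with hc | hc
      · rw [hec] at hc; simp at hc
      · exact hc
    subst hcx
    have ins : ∀ z, c ≠ z → insert c (e.erase z) = V.erase z := by
      intro z hz
      rw [hVV]
      ext y
      simp only [Finset.mem_insert, Finset.mem_erase, Finset.mem_union, Finset.mem_singleton]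
      constructor
      · rintro (h | h)
        · subst h; exact ⟨hz, Or.inr rfl⟩
        · exact ⟨h.1, Or.inl h.2⟩
      · tauto
    refine ⟨d, d', ?_, ?_, hdd, ?_, ?_⟩
    · rw [hec]; exact Finset.mem_erase.2 ⟨hcd.symm, hd⟩
    · rw [hec]; exact Finset.mem_erase.2 ⟨hcd'.symm, hd'⟩
    · rw [ins d hcd]; exact hdG
    · rw [ins d' hcd']; exact hdG'
  have g0 : V.erase (f 0) ∈ G := by rw [hGf]; simp
  have g1 : V.erase (f 1) ∈ G := by rw [hGf]; simp
  have g2 : V.erase (f 2) ∈ G := by rw [hGf]; simp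
  have he' := he
  rw [hGf] at he'
  simp only [Finset.mem_insert, Finset.mem_singleton] at he'
  rcases he' with h | h | h
  · exact key _ _ _ m2 m0 m1 n02.symm n12.symm n01 h g0 g1
  · exact key _ _ _ m1 m0 m2 n01.symm n12 n02 h g0 g2
  · exact key _ _ _ m0 m1 m2 n01 n02 n12 h g1 g2

lemma mem_cycEdge (k t i x : ℕ) (hkt : 2 * k ≤ t) (hi : i < t) :
    x ∈ cycEdge k t i ↔ (i ≤ x ∧ x < i + k ∧ x < t) ∨ (x + t < i + k) := by
  unfold cycEdge
  simp only [Finset.mem_image, Finset.mem_range]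
  constructor
  · rintro ⟨j, hj, rfl⟩
    by_cases h : i + j < t
    · rw [Nat.mod_eq_of_lt h]; omega
    · rw [Nat.mod_eq_sub_mod (by omega), Nat.mod_eq_of_lt (by omega)]; omega
  · rintro (h | h)
    · exact ⟨x - i, by omega, by rw [Nat.mod_eq_of_lt (by omega)]; omega⟩
    · refine ⟨x + t - i, by omega, ?_⟩
      rw [show i + (x + t - i) = x + t by omega, Nat.add_mod_right, Nat.mod_eq_of_lt (by omega)]

/-- the last vertex of the `m`-th edge -/
def lastV (k t m : ℕ) : ℕ := if m + k - 1 < t then m + k - 1 else m + k - 1 - t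

lemma last_key (k t j m a : ℕ) (hk : 4 ≤ k) (hkt : 2 * k ≤ t) (hj : 1 ≤ j) (hjm : j < m)
    (hm : m < t) (ha : a ≠ lastV k t m)
    (hsub : (cycEdge k t m).erase a ⊆ cycEdge k t j) : False := by
  have H : ∀ x, x ≠ a → x ∈ cycEdge k t m → x ∈ cycEdge k t j :=
    fun x h1 h2 => hsub (Finset.mem_erase.2 ⟨h1, h2⟩)
  simp only [mem_cycEdge k t _ _ hkt hm, mem_cycEdge k t j _ hkt (by omega)] at H
  have Hw := H _ ha.symm
  unfold lastV at Hw
  split_ifs at Hw with h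
  · have := Hw (by omega); omega
  · have := Hw (by omega)
    by_cases h0 : a = 0
    · have := H (t - 1) (by omega) (by omega); omega
    · have := H 0 (by omega) (by omega); omega

lemma one_vertex (k t s : ℕ) (hk : 4 ≤ k) (hkt : 2 * k ≤ t) (hs : s ∉ Finset.range t)
    (a b : ℕ → ℕ) (J : Finset ℕ) (hne : J.Nonempty) (hJ : ∀ j ∈ J, 1 ≤ j ∧ j < t)
    (hab : ∀ j ∈ J, a j ∈ cycEdge k t j ∧ b j ∈ cycEdge k t j ∧ a j ≠ b j) :
    J.card + 1 ≤ (J.biUnion (fun j => ({insert s ((cycEdge k t j).erase (a j)),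
      insert s ((cycEdge k t j).erase (b j))} : Finset (Finset ℕ)))).card := by
  have hsE : ∀ j, j < t → s ∉ cycEdge k t j := by
    intro j hj h
    rw [mem_cycEdge k t j s hkt hj] at h
    simp at hs; omega
  have hsub : ∀ j m c d, j < t → m < t → insert s ((cycEdge k t m).erase c) =
      insert s ((cycEdge k t j).erase d) → (cycEdge k t m).erase c ⊆ cycEdge k t j := by
    intro j m c d hj hm h x hx
    have h1 : x ∈ insert s ((cycEdge k t j).erase d) := by
      rw [← h]; exact Finset.mem_insert_of_mem hx
    rcases Finset.mem_insert.1 h1 with h2 | h2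
    · subst h2; exact absurd (Finset.mem_of_mem_erase hx) (hsE m hm)
    · exact Finset.mem_of_mem_erase h2
  induction J using Finset.induction_on_max with
  | empty => simp at hne
  | insert m J hmax ih =>
    have hmJ : m ∉ J := fun h => lt_irrefl _ (hmax m h)
    obtain ⟨hm1, hmt⟩ := hJ m (Finset.mem_insert_self _ _)
    obtain ⟨ham, hbm, habm⟩ := hab m (Finset.mem_insert_self _ _)
    rw [Finset.biUnion_insert, Finset.card_insert_of_notMem hmJ]
    rcases J.eq_empty_or_nonempty with rfl | hJne
    · simp only [Finset.card_empty, Finset.biUnion_empty, Finset.union_empty]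
      rw [Finset.card_pair]
      intro h
      have h1 : b m ∈ insert s ((cycEdge k t m).erase (b m)) := by
        rw [← h]
        exact Finset.mem_insert_of_mem (Finset.mem_erase.2 ⟨habm.symm, hbm⟩)
      rcases Finset.mem_insert.1 h1 with h2 | h2
      · rw [← h2] at hsE; exact hsE m hmt hbm
      · simp at h2
    · have ih' := ih hJne (fun j hj => hJ j (Finset.mem_insert_of_mem hj))
        (fun j hj => hab j (Finset.mem_insert_of_mem hj))
      have hnew : ∀ c, c ≠ lastV k t m → insert s ((cycEdge k t m).erase c) ∉
          (J.biUnion (fun j => ({insert s ((cycEdge k t j).erase (a j)),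
            insert s ((cycEdge k t j).erase (b j))} : Finset (Finset ℕ)))) := by
        intro c hc hmem
        simp only [Finset.mem_biUnion, Finset.mem_insert, Finset.mem_singleton] at hmem
        obtain ⟨j, hj, h⟩ := hmem
        obtain ⟨hj1, hjt⟩ := hJ j (Finset.mem_insert_of_mem hj)
        rcases h with h | h
        · exact last_key k t j m c hk hkt hj1 (hmax j hj) hmt hc (hsub j m _ _ hjt hmt h)
        · exact last_key k t j m c hk hkt hj1 (hmax j hj) hmt hc (hsub j m _ _ hjt hmt h)
      obtain ⟨c, hc, hcl⟩ : ∃ c, (c = a m ∨ c = b m) ∧ c ≠ lastV k t m := by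
        by_cases h : a m = lastV k t m
        · exact ⟨b m, Or.inr rfl, fun h' => habm (h.trans h'.symm)⟩
        · exact ⟨a m, Or.inl rfl, h⟩
      have hcard := Finset.card_insert_of_notMem (hnew c hcl)
      have hle : _ ≤ _ := Finset.card_le_card (Finset.insert_subset_iff.2
        ⟨show insert s ((cycEdge k t m).erase c) ∈ ({insert s ((cycEdge k t m).erase (a m)),
          insert s ((cycEdge k t m).erase (b m))} : Finset (Finset ℕ)) ∪
          (J.biUnion (fun j => ({insert s ((cycEdge k t j).erase (a j)),
            insert s ((cycEdge k t j).erase (b j))} : Finset (Finset ℕ)))) from ?_,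
          Finset.subset_union_right⟩)
      · omega
      · rcases hc with rfl | rfl <;> simp

/-- for a member `C*` of `F*(K₃^{+k}, C_{t_k})` with labelled cycle, the
number of edges incident to a set `S = {v_i : i ∈ I}` of outside apex vertices is at least
`|I| + |S|`. -/
theorem outside_vertices (k : ℕ) (hk : 4 ≤ k)
    (Cst : Finset (Finset ℕ)) (g : ℕ → Finset (Finset ℕ)) (v : ℕ → ℕ)
    (hg : ∀ i : ℕ, 1 ≤ i → i ≤ tk k - 1 →
      IsCopy (K3plus k) (g i) ∧ cycEdge k (tk k) i ∈ g i ∧ g i ⊆ Cst ∧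
        vset (g i) = cycEdge k (tk k) i ∪ {v i})
    (hC : Cst = tightCycle k (tk k) ∪ (Finset.Icc 1 (tk k - 1)).biUnion g)
    (I : Finset ℕ)
    (hI : I ⊆ (Finset.Icc 1 (tk k - 1)).filter (fun i => v i ∉ Finset.range (tk k)))
    (S : Finset ℕ) (hS : S = I.image v) :
    I.card + S.card ≤ (Cst.filter (fun e => ∃ x ∈ S, x ∈ e)).card := by
  have hkt := tk_ge k hk
  generalize tk k = t at *
  have hI' : ∀ i ∈ I, 1 ≤ i ∧ i < t ∧ v i ∉ Finset.range t := by
    intro i hi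
    have := hI hi
    rw [Finset.mem_filter, Finset.mem_Icc] at this
    exact ⟨this.1.1, by omega, this.2⟩
  have hcr : ∀ i, i < t → ∀ x ∈ cycEdge k t i, x ∈ Finset.range t := by
    intro i hi x hx
    rw [mem_cycEdge k t i x hkt hi] at hx
    simp; omega
  have hex : ∀ i, ∃ a b, i ∈ I → a ∈ cycEdge k t i ∧ b ∈ cycEdge k t i ∧ a ≠ b ∧
      insert (v i) ((cycEdge k t i).erase a) ∈ Cst ∧
      insert (v i) ((cycEdge k t i).erase b) ∈ Cst := by
    intro i
    by_cases hi : i ∈ I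
    · obtain ⟨h1, h2, h3⟩ := hI' i hi
      obtain ⟨c1, c2, c3, c4⟩ := hg i h1 (by omega)
      obtain ⟨a, b, ha, hb, hab, hA, hB⟩ := two_edges k hk (g i) c1 _ (v i) c2
        (fun h => h3 (hcr i h2 _ h)) (by convert c4)
      exact ⟨a, b, fun _ => ⟨ha, hb, hab, by convert c3 hA, by convert c3 hB⟩⟩
    · exact ⟨0, 0, fun h => absurd h hi⟩
  choose a b hab using hex
  let U : ℕ → Finset (Finset ℕ) := fun s => (I.filter (fun i => v i = s)).biUnion
    (fun j => ({insert s ((cycEdge k t j).erase (a j)),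
      insert s ((cycEdge k t j).erase (b j))} : Finset (Finset ℕ)))
  have hUmem : ∀ s X, X ∈ U s → s ∈ X ∧ X ∈ Cst ∧ ∀ y ∈ X, y = s ∨ y ∈ Finset.range t := by
    intro s X hX
    simp only [U, Finset.mem_biUnion, Finset.mem_filter, Finset.mem_insert,
      Finset.mem_singleton] at hX
    obtain ⟨j, ⟨hj, rfl⟩, h⟩ := hX
    obtain ⟨_, _, _, hA, hB⟩ := hab j hj
    rcases h with rfl | rfl
    · refine ⟨by simp, hA, fun y hy => ?_⟩
      rcases Finset.mem_insert.1 hy with h | h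
      · exact Or.inl h
      · exact Or.inr (hcr j (hI' j hj).2.1 _ (Finset.mem_of_mem_erase h))
    · refine ⟨by simp, hB, fun y hy => ?_⟩
      rcases Finset.mem_insert.1 hy with h | h
      · exact Or.inl h
      · exact Or.inr (hcr j (hI' j hj).2.1 _ (Finset.mem_of_mem_erase h))
  have hSr : ∀ s ∈ S, s ∉ Finset.range t := by
    intro s hs
    rw [hS, Finset.mem_image] at hs
    obtain ⟨i, hi, rfl⟩ := hs
    exact (hI' i hi).2.2
  have hdisj : ∀ s ∈ S, ∀ s' ∈ S, s ≠ s' → Disjoint (U s) (U s') := by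
    intro s hs s' hs' hne
    rw [Finset.disjoint_left]
    intro X hX hX'
    rcases (hUmem s' X hX').2.2 s (hUmem s X hX).1 with h | h
    · exact hne h
    · exact hSr s hs h
  have hsub : S.biUnion U ⊆ Cst.filter (fun e => ∃ x ∈ S, x ∈ e) := by
    intro X hX
    obtain ⟨s, hs, hX⟩ := Finset.mem_biUnion.1 hX
    obtain ⟨h1, h2, _⟩ := hUmem s X hX
    exact Finset.mem_filter.2 ⟨h2, s, hs, h1⟩
  have hIc : I.card = ∑ s ∈ S, (I.filter (fun i => v i = s)).card :=
    Finset.card_eq_sum_card_fiberwise (fun i hi => by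
      rw [hS]; exact Finset.mem_coe.2 (Finset.mem_image_of_mem v hi))
  calc I.card + S.card = ∑ s ∈ S, ((I.filter (fun i => v i = s)).card + 1) := by
        rw [Finset.sum_add_distrib, ← hIc]; simp
    _ ≤ ∑ s ∈ S, (U s).card := by
        refine Finset.sum_le_sum fun s hs => ?_
        refine one_vertex k t s hk hkt (hSr s hs) a b _ ?_ ?_ ?_
        · have hs2 := hs
          rw [hS, Finset.mem_image] at hs2
          obtain ⟨i, hi, h⟩ := hs2
          exact ⟨i, Finset.mem_filter.2 ⟨hi, h⟩⟩
        · intro j hj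
          have := hI' j (Finset.mem_filter.1 hj).1
          exact ⟨this.1, this.2.1⟩
        · intro j hj
          have := hab j (Finset.mem_filter.1 hj).1
          exact ⟨this.1, this.2.1, this.2.2.1⟩
    _ = (S.biUnion U).card := (Finset.card_biUnion hdisj).symm
    _ ≤ _ := Finset.card_le_card hsub

end ARR
end

section
/- Let H be a 3-uniform hypergraph with 7 edges which contains no 1-intersecting set of three edges. Then there exists a 1-intersecting subset S ⊆ E(H) of edges such that the hypergraph H with the edges of S removed does not contain a copy of the tight path T^3_6. -/
open scoped Classical

namespace ARR

def Cl (x y : Finset ℕ) : Prop := ∃ u v, u ≠ v ∧ u ∈ x ∧ u ∈ y ∧ v ∈ x ∧ v ∈ y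

lemma cl_of_card {x y : Finset ℕ} (h : ¬ (x ∩ y).card ≤ 1) : Cl x y := by
  have h' : 1 < (x ∩ y).card := by omega
  obtain ⟨u, hu, v, hv, huv⟩ := Finset.one_lt_card.1 h'
  simp only [Finset.mem_inter] at hu hv
  exact ⟨u, v, huv, hu.1, hu.2, hv.1, hv.2⟩

lemma Cl.symm {x y : Finset ℕ} (h : Cl x y) : Cl y x := by
  obtain ⟨u, v, h1, h2, h3, h4, h5⟩ := h
  exact ⟨u, v, h1, h3, h2, h5, h4⟩

/-- tight path with given edges -/
def TP (p1 p2 p3 p4 : Finset ℕ) : Prop := ∃ a b c d e f : ℕ, [a, b, c, d, e, f].Nodup ∧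
  p1 = {a, b, c} ∧ p2 = {b, c, d} ∧ p3 = {c, d, e} ∧ p4 = {d, e, f}

lemma TP.symm {p1 p2 p3 p4 : Finset ℕ} (h : TP p1 p2 p3 p4) : TP p4 p3 p2 p1 := by
  obtain ⟨a, b, c, d, e, f, hn, rfl, rfl, rfl, rfl⟩ := h
  refine ⟨f, e, d, c, b, a, ?_, ?_, ?_, ?_, ?_⟩
  · have := List.nodup_reverse.2 hn
    simpa using this
  all_goals (ext x; simp only [Finset.mem_insert, Finset.mem_singleton]; tauto)

lemma TP.facts {p1 p2 p3 p4 : Finset ℕ} (h : TP p1 p2 p3 p4) :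
    Cl p1 p2 ∧ Cl p2 p3 ∧ Cl p3 p4 ∧ (∀ x ∈ p1, x ∉ p4) ∧ ¬ Cl p1 p3 ∧ ¬ Cl p2 p4 ∧
    p1 ≠ p2 ∧ p3 ≠ p4 := by
  obtain ⟨a, b, c, d, e, f, hn, rfl, rfl, rfl, rfl⟩ := h
  simp only [List.nodup_cons, List.mem_cons, List.not_mem_nil, or_false, not_or] at hn
  obtain ⟨⟨h1, h2, h3, h4, h5⟩, ⟨h6, h7, h8, h9⟩, ⟨h10, h11, h12⟩, ⟨h13, h14⟩, h15, -⟩ := hn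
  refine ⟨⟨b, c, ?_⟩, ⟨c, d, ?_⟩, ⟨d, e, ?_⟩, ?_, ?_, ?_, ?_, ?_⟩
  · simp [*]
  · simp [*]
  · simp [*]
  · intro x hx; simp only [Finset.mem_insert, Finset.mem_singleton] at *; grind
  · rintro ⟨u, v, h⟩; simp only [Finset.mem_insert, Finset.mem_singleton] at *; grind
  · rintro ⟨u, v, h⟩; simp only [Finset.mem_insert, Finset.mem_singleton] at *; grind
  · intro h; have : a ∈ ({b, c, d} : Finset ℕ) := h ▸ (by simp)
    simp only [Finset.mem_insert, Finset.mem_singleton] at this; grind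
  · intro h; have : c ∈ ({d, e, f} : Finset ℕ) := h ▸ (by simp)
    simp only [Finset.mem_insert, Finset.mem_singleton] at this; grind

lemma tp_of_copy {G : Finset (Finset ℕ)} (h : ContainsCopy G (tightPath 3 6)) :
    ∃ p1 ∈ G, ∃ p2 ∈ G, ∃ p3 ∈ G, ∃ p4 ∈ G, TP p1 p2 p3 p4 := by
  obtain ⟨F', hF, φ, hinj, rfl⟩ := h
  have ht : tightPath 3 6 = {{0,1,2},{1,2,3},{2,3,4},{3,4,5}} := by decide
  have hv : vset (tightPath 3 6) = {0,1,2,3,4,5} := by rw [ht]; decide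
  rw [hv] at hinj
  rw [ht] at hF
  refine ⟨{φ 0, φ 1, φ 2}, hF (by simp [Finset.image_insert]), {φ 1, φ 2, φ 3},
    hF (by simp [Finset.image_insert]), {φ 2, φ 3, φ 4}, hF (by simp [Finset.image_insert]),
    {φ 3, φ 4, φ 5}, hF (by simp [Finset.image_insert]),
    φ 0, φ 1, φ 2, φ 3, φ 4, φ 5, ?_, rfl, rfl, rfl, rfl⟩
  have h2 : ([0,1,2,3,4,5].map φ).Nodup := by
    refine List.Nodup.map_on ?_ (by decide)
    intro x hx y hy hxy
    exact hinj (by simpa using hx) (by simpa using hy) hxy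
  simpa using h2

lemma three {x : Finset ℕ} (hx : x.card = 3) {u v w : ℕ} (hu : u ∈ x) (hv : v ∈ x) (hw : w ∈ x)
    (h1 : u ≠ v) (h2 : u ≠ w) (h3 : v ≠ w) : x = {u, v, w} := by
  symm
  apply Finset.eq_of_subset_of_card_le
  · intro t ht; simp only [Finset.mem_insert, Finset.mem_singleton] at ht; grind
  · rw [hx, Finset.card_eq_three.2 ⟨u, v, w, h1, h2, h3, rfl⟩]

lemma three' {x : Finset ℕ} (hx : x.card = 3) {u v : ℕ} (hu : u ∈ x) (hv : v ∈ x)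
    (h1 : u ≠ v) : ∃ w, u ≠ w ∧ v ≠ w ∧ x = {u, v, w} := by
  have : ∃ w ∈ x, w ∉ ({u, v} : Finset ℕ) := by
    apply Finset.exists_mem_notMem_of_card_lt_card
    rw [hx]
    exact lt_of_le_of_lt Finset.card_le_two (by norm_num)
  obtain ⟨w, hw, hw'⟩ := this
  simp only [Finset.mem_insert, Finset.mem_singleton, not_or] at hw'
  exact ⟨w, Ne.symm hw'.1, Ne.symm hw'.2, three hx hu hv hw h1 (Ne.symm hw'.1) (Ne.symm hw'.2)⟩

/-- shape of an edge close to both `abc` and `bcd`. -/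
lemma shape {x : Finset ℕ} (hx : x.card = 3) {a b c d : ℕ} (hab : a ≠ b) (hac : a ≠ c)
    (had : a ≠ d) (hbc : b ≠ c) (hbd : b ≠ d) (hcd : c ≠ d)
    (h1 : Cl x {a, b, c}) (h2 : Cl x {b, c, d}) :
    (∃ t, b ≠ t ∧ c ≠ t ∧ x = {b, c, t}) ∨ x = {a, b, d} ∨ x = {a, c, d} := by
  by_cases hb : b ∈ x <;> by_cases hc : c ∈ x
  · exact Or.inl (three' hx hb hc hbc)
  · right; left
    obtain ⟨u, v, h⟩ := h1
    obtain ⟨u', v', h'⟩ := h2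
    simp only [Finset.mem_insert, Finset.mem_singleton] at h h'
    exact three hx (by grind) hb (by grind) hab had hbd
  · right; right
    obtain ⟨u, v, h⟩ := h1
    obtain ⟨u', v', h'⟩ := h2
    simp only [Finset.mem_insert, Finset.mem_singleton] at h h'
    exact three hx (by grind) hc (by grind) hac had hcd
  · exfalso
    obtain ⟨u, v, h⟩ := h1
    simp only [Finset.mem_insert, Finset.mem_singleton] at h
    grind

set_option maxHeartbeats 2000000 in
lemma final {a b c d e f : ℕ} (hn : [a, b, c, d, e, f].Nodup) {h p q : Finset ℕ}
    (hh : h.card = 3) (hp : p.card = 3) (hq : q.card = 3)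
    (h1 : Cl h {d, e, f}) (h2 : Cl h {c, d, e}) (hne : h ≠ {c, d, e})
    (p1 : Cl p {a, b, c}) (p2 : Cl p {b, c, d}) (hph : ∀ x ∈ p, x ∉ h)
    (q1 : Cl q {a, b, c}) (q2 : Cl q {b, c, d}) (hqh : Cl q h) (hqp : Cl q p) : False := by
  simp only [List.nodup_cons, List.mem_cons, List.not_mem_nil, or_false, not_or] at hn
  obtain ⟨⟨n1, n2, n3, n4, n5⟩, ⟨n6, n7, n8, n9⟩, ⟨n10, n11, n12⟩, ⟨n13, n14⟩, n15, -⟩ := hn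
  have P := shape hp n1 n2 n3 n6 n7 n10 p1 p2
  have Q := shape hq n1 n2 n3 n6 n7 n10 q1 q2
  have e1 : ({d, e, f} : Finset ℕ) = {f, e, d} := by
    ext x; simp only [Finset.mem_insert, Finset.mem_singleton]; tauto
  have e2 : ({c, d, e} : Finset ℕ) = {e, d, c} := by
    ext x; simp only [Finset.mem_insert, Finset.mem_singleton]; tauto
  rw [e1] at h1
  rw [e2] at h2 hne
  have B := shape hh (Ne.symm n15) (Ne.symm n14) (Ne.symm n12) (Ne.symm n13) (Ne.symm n11)
    (Ne.symm n10) h1 h2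
  obtain ⟨u, v, huv, u1, u2, v1, v2⟩ := hqh
  obtain ⟨u', v', huv', u1', u2', v1', v2'⟩ := hqp
  clear hh hp hq h1 h2 hne p1 p2 q1 q2 e1 e2
  rcases P with ⟨t, t1, t2, rfl⟩ | rfl | rfl <;> rcases Q with ⟨s, s1, s2, rfl⟩ | rfl | rfl <;>
  rcases B with ⟨r, r1, r2, rfl⟩ | rfl | rfl <;>
  simp only [Finset.mem_insert, Finset.mem_singleton, forall_eq_or_imp, forall_eq, not_or] at * <;>
  grind

lemma core (H : Finset (Finset ℕ)) (hu : IsUniform 3 H)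
    (hno : ∀ x ∈ H, ∀ y ∈ H, ∀ z ∈ H, Cl x y ∨ Cl y z ∨ Cl x z)
    (hpath : ∀ s ∈ H, ∃ p1 ∈ H, ∃ p2 ∈ H, ∃ p3 ∈ H, ∃ p4 ∈ H, TP p1 p2 p3 p4 ∧
      p1 ≠ s ∧ p2 ≠ s ∧ p3 ≠ s ∧ p4 ≠ s)
    {e1 e2 e3 e4 : Finset ℕ} (m1 : e1 ∈ H) (m2 : e2 ∈ H) (m3 : e3 ∈ H) (m4 : e4 ∈ H)
    (he : TP e1 e2 e3 e4) (hB : (H.filter (fun x => Cl x e4)).card ≤ 3) : False := by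
  obtain ⟨f12, f23, f34, f14, f13, f24, ne12, ne34⟩ := he.facts
  have n14 : ¬ Cl e1 e4 := by rintro ⟨u, v, h⟩; exact f14 u h.2.1 h.2.2.1
  have cov : ∀ x ∈ H, Cl x e1 ∨ Cl x e4 := by
    intro x hx
    rcases hno x hx e1 m1 e4 m4 with h | h | h
    · exact Or.inl h
    · exact absurd h n14
    · exact Or.inr h
  have exc : ∀ x ∈ H, Cl x e1 → Cl x e4 → False := by
    rintro x hx ⟨u, v, h⟩ ⟨u', v', h'⟩
    have := three (hu x hx) h.2.1 h.2.2.2.1 h'.2.1 h.1 (by grind) (by grind)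
    have h4 := h'.2.2.2.1
    rw [this] at h4
    simp only [Finset.mem_insert, Finset.mem_singleton] at h4
    grind
  have cA : ∀ x ∈ H, ∀ y ∈ H, Cl x e1 → Cl y e1 → Cl x y := by
    intro x hx y hy h1 h2
    rcases hno x hx y hy e4 m4 with h | h | h
    · exact h
    · exact (exc y hy h2 h).elim
    · exact (exc x hx h1 h).elim
  have cB : ∀ x ∈ H, ∀ y ∈ H, Cl x e4 → Cl y e4 → Cl x y := by
    intro x hx y hy h1 h2
    rcases hno x hx y hy e1 m1 with h | h | h
    · exact h
    · exact (exc y hy h h2).elim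
    · exact (exc x hx h h1).elim
  have aux : ∀ p1 ∈ H, ∀ p2 ∈ H, ∀ p3 ∈ H, ∀ p4 ∈ H, TP p1 p2 p3 p4 → Cl p1 e1 →
      Cl p2 e1 ∧ Cl p3 e4 ∧ Cl p4 e4 := by
    intro p1 k1 p2 k2 p3 k3 p4 k4 hp h1
    obtain ⟨g12, g23, g34, g14, g13, g24, -, -⟩ := hp.facts
    have h4 : Cl p4 e4 := by
      rcases cov p4 k4 with h | h
      · obtain ⟨u, v, h⟩ := cA p1 k1 p4 k4 h1 h
        exact (g14 u h.2.1 h.2.2.1).elim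
      · exact h
    refine ⟨?_, ?_, h4⟩
    · rcases cov p2 k2 with h | h
      · exact h
      · exact (g24 (cB p2 k2 p4 k4 h h4)).elim
    · rcases cov p3 k3 with h | h
      · exact (g13 (cA p1 k1 p3 k3 h1 h)).elim
      · exact h
  have path : ∀ s ∈ H, ∃ p1 ∈ H, ∃ p2 ∈ H, ∃ p3 ∈ H, ∃ p4 ∈ H, TP p1 p2 p3 p4 ∧
      p3 ≠ s ∧ p4 ≠ s ∧ Cl p1 e1 ∧ Cl p2 e1 ∧ Cl p3 e4 ∧ Cl p4 e4 := by
    intro s hs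
    obtain ⟨p1, k1, p2, k2, p3, k3, p4, k4, hp, s1, s2, s3, s4⟩ := hpath s hs
    rcases cov p1 k1 with h | h
    · exact ⟨p1, k1, p2, k2, p3, k3, p4, k4, hp, s3, s4, h, aux p1 k1 p2 k2 p3 k3 p4 k4 hp h⟩
    · have h4 : Cl p4 e1 := by
        rcases cov p4 k4 with h' | h'
        · exact h'
        · obtain ⟨u, v, h⟩ := cB p1 k1 p4 k4 h h'
          exact (hp.facts.2.2.2.1 u h.2.1 h.2.2.1).elim
      exact ⟨p4, k4, p3, k3, p2, k2, p1, k1, hp.symm, s2, s1, h4,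
        aux p4 k4 p3 k3 p2 k2 p1 k1 hp.symm h4⟩
  obtain ⟨a1, a2, a3, a4⟩ : Cl e1 e1 ∧ Cl e2 e1 ∧ Cl e3 e4 ∧ Cl e4 e4 := by
    have : Cl e1 e1 := by obtain ⟨u, v, h⟩ := f12; exact ⟨u, v, h.1, h.2.1, h.2.1, h.2.2.2.1, h.2.2.2.1⟩
    exact ⟨this, aux e1 m1 e2 m2 e3 m3 e4 m4 he this⟩
  have three_el : ∀ w ∈ H, ∀ x ∈ H, Cl w e4 → Cl x e4 → w ≠ e3 → w ≠ e4 → x ≠ e3 → x ≠ e4 →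
      w = x := by
    intro w hw x hx cw cx w3 w4 x3 x4
    by_contra hne
    have hs : ({e3, e4, w, x} : Finset (Finset ℕ)) ⊆ H.filter (fun x => Cl x e4) := by
      intro y hy
      simp only [Finset.mem_insert, Finset.mem_singleton] at hy
      rw [Finset.mem_filter]
      rcases hy with rfl | rfl | rfl | rfl <;> exact ⟨by assumption, by assumption⟩
    have hc := Finset.card_le_card hs
    have : ({e3, e4, w, x} : Finset (Finset ℕ)).card = 4 := by
      rw [Finset.card_insert_of_notMem, Finset.card_insert_of_notMem,
        Finset.card_insert_of_notMem, Finset.card_singleton]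
      · simpa using hne
      · simp [Ne.symm w4, Ne.symm x4]
      · simp [Ne.symm w3, Ne.symm x3, ne34]
    omega
  obtain ⟨p1, k1, p2, k2, p3, k3, p4, k4, hp, s3, s4, b1, b2, b3, b4⟩ := path e4 m4
  obtain ⟨q1, l1, q2, l2, q3, l3, q4, l4, hq, t3, t4, c1, c2, c3, c4⟩ := path e3 m3
  obtain ⟨-, -, -, p14, -, -, -, pne⟩ := hp.facts
  obtain ⟨-, q23, -, q14, -, -, -, qne⟩ := hq.facts
  have hp4 : p4 ≠ e3 := by
    rintro rfl
    obtain ⟨u, v, g1, g2, g3, g4, g5⟩ := cA p1 k1 e2 m2 b1 a2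
    obtain ⟨a, b, c, d, e, f, hn, rfl, rfl, rfl, rfl⟩ := he
    have := p14 u g2
    have := p14 v g4
    simp only [Finset.mem_insert, Finset.mem_singleton] at *
    grind
  have hq3 : q3 ≠ e4 := by
    rintro rfl
    exact exc q2 l2 c2 q23
  have hpq : q3 = p4 := three_el _ l3 _ k4 c3 b4 t3 hq3 hp4 s4
  subst hpq
  obtain ⟨a, b, c, d, e, f, hn, rfl, rfl, rfl, rfl⟩ := id he
  exact final hn (hu _ l3) (hu _ k1) (hu _ l2) c3 (cB _ l3 _ m3 c3 a3) t3 b1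
    (cA _ k1 _ m2 b1 a2) p14 c2 (cA _ l2 _ m2 c2 a2) q23 (cA _ l2 _ k1 c2 b1)

/-- every 3-uniform hypergraph with 7 edges and no 1-intersecting set of three
edges has a 1-intersecting edge set whose removal destroys all copies of `T³₆`. -/
theorem l4_special (H : Finset (Finset ℕ)) (hu : IsUniform 3 H) (hcard : H.card = 7)
    (hno : ∀ S ⊆ H, S.card = 3 → ¬ IntersectingLE 1 S) :
    ∃ S ⊆ H, IntersectingLE 1 S ∧ ¬ ContainsCopy (H \ S) (tightPath 3 6) := by
  by_contra hcon
  push Not at hcon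
  have clself : ∀ x ∈ H, Cl x x := by
    intro x hx
    apply cl_of_card
    rw [Finset.inter_self, hu x hx]; norm_num
  have hno' : ∀ x ∈ H, ∀ y ∈ H, ∀ z ∈ H, Cl x y ∨ Cl y z ∨ Cl x z := by
    intro x hx y hy z hz
    by_contra hc
    push Not at hc
    obtain ⟨h1, h2, h3⟩ := hc
    have n1 : x ≠ y := by rintro rfl; exact h1 (clself _ hx)
    have n2 : y ≠ z := by rintro rfl; exact h2 (clself _ hy)
    have n3 : x ≠ z := by rintro rfl; exact h3 (clself _ hx)
    refine hno {x, y, z} ?_ (Finset.card_eq_three.2 ⟨x, y, z, n1, n3, n2, rfl⟩) ?_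
    · intro w hw
      simp only [Finset.mem_insert, Finset.mem_singleton] at hw
      rcases hw with rfl | rfl | rfl <;> assumption
    · intro u hu' v hv huv
      by_contra hcl
      have hcl := cl_of_card hcl
      have hcl' := hcl.symm
      simp only [Finset.mem_insert, Finset.mem_singleton] at hu' hv
      rcases hu' with rfl | rfl | rfl <;> rcases hv with rfl | rfl | rfl <;> contradiction
  have hpath : ∀ s ∈ H, ∃ p1 ∈ H, ∃ p2 ∈ H, ∃ p3 ∈ H, ∃ p4 ∈ H, TP p1 p2 p3 p4 ∧
      p1 ≠ s ∧ p2 ≠ s ∧ p3 ≠ s ∧ p4 ≠ s := by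
    intro s hs
    obtain ⟨p1, k1, p2, k2, p3, k3, p4, k4, hp⟩ := tp_of_copy (hcon {s} (by simpa using hs) (by
      intro e he f hf hef
      simp only [Finset.mem_singleton] at he hf
      exact absurd (he.trans hf.symm) hef))
    simp only [Finset.mem_sdiff, Finset.mem_singleton] at k1 k2 k3 k4
    exact ⟨p1, k1.1, p2, k2.1, p3, k3.1, p4, k4.1, hp, k1.2, k2.2, k3.2, k4.2⟩
  have hne : H.Nonempty := by
    rw [← Finset.card_pos]; omega
  obtain ⟨s, hs⟩ := hne
  obtain ⟨e1, m1, e2, m2, e3, m3, e4, m4, he, -⟩ := hpath s hs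
  by_cases hB : (H.filter (fun x => Cl x e4)).card ≤ 3
  · exact core H hu hno' hpath m1 m2 m3 m4 he hB
  · refine core H hu hno' hpath m4 m3 m2 m1 he.symm ?_
    have hd : Disjoint (H.filter (fun x => Cl x e4)) (H.filter (fun x => Cl x e1)) := by
      rw [Finset.disjoint_filter]
      rintro x hx ⟨u', v', h'⟩ ⟨u, v, h⟩
      have f14 := he.facts.2.2.2.1
      have := three (hu x hx) h.2.1 h.2.2.2.1 h'.2.1 h.1 (by grind) (by grind)
      have h4 := h'.2.2.2.1
      rw [this] at h4
      simp only [Finset.mem_insert, Finset.mem_singleton] at h4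
      grind
    have := Finset.card_le_card (Finset.union_subset
      (Finset.filter_subset (fun x => Cl x e4) H) (Finset.filter_subset (fun x => Cl x e1) H))
    rw [Finset.card_union_of_disjoint hd] at this
    omega

end ARR
end
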